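/- arXiv:1405.0113 — 2 statements merged into one kernel-verified Lean document; each statement's English description precedes it below -/
import Mathlib

section
/- Let n ≥ 1 and d be integers with |d| ≥ 2. Then the images in ℚ[x]/(x^n − 1) of the elements f_v, 1 ≤ v ≤ n−1, are linearly independent over ℚ, the group S(n,d) = 𝒵_n/F_{n,d} is finite, and S(n,d) is isomorphic to the torsion subgroup of the quotient of ℤ^n by the subgroup generated by the rows of the Laplacian Δ of DB(n,d) (if d ≥ 2) or of Ktz(n,|d|) (if d ≤ −2); that is, S(n,d) is the critical group of the corresponding graph. -/
open Finset

noncomputable section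

/-- The ring `ℤ[x]/(x^n - 1)`, realized as the group algebra `ℤ[ℤ/n]`;
the class of `x^j` (for `j : ℤ`) corresponds to `xp n (j : ZMod n)`. -/
abbrev Rn (n : ℕ) : Type := AddMonoidAlgebra ℤ (ZMod n)

/-- The class of `x^w` in `ℤ[x]/(x^n - 1)`. -/
def xp (n : ℕ) (w : ZMod n) : Rn n := AddMonoidAlgebra.single w 1

/-- `e_v = x^v - 1`. -/
def eV (n : ℕ) (w : ZMod n) : Rn n := xp n w - 1

/-- `ε_v = d·e_v - e_{d·v}`. -/
def epsV (n : ℕ) (d : ℤ) (w : ZMod n) : Rn n := d • eV n w - eV n ((d : ZMod n) * w)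

/-- `𝒵_n`, the ℤ-span of the `e_v`, `1 ≤ v ≤ n-1`. -/
def ZSpan (n : ℕ) : Submodule ℤ (Rn n) :=
  Submodule.span ℤ {a : Rn n | ∃ v : ℤ, 1 ≤ v ∧ v ≤ (n : ℤ) - 1 ∧ a = eV n (v : ZMod n)}

/-- `ℰ_{n,d}`, the ℤ-span of the `ε_v`, `1 ≤ v ≤ n-1`. -/
def ESpan (n : ℕ) (d : ℤ) : Submodule ℤ (Rn n) :=
  Submodule.span ℤ {a : Rn n | ∃ v : ℤ, 1 ≤ v ∧ v ≤ (n : ℤ) - 1 ∧ a = epsV n d (v : ZMod n)}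

/-- `1 + x + ⋯ + x^{|d|-1}`. -/
def geomT (n : ℕ) (d : ℤ) : Rn n := ∑ i ∈ Finset.range d.natAbs, xp n (i : ZMod n)

/-- `f_v`: the Laplacian row polynomial of `DB(n,d)` (for `d ≥ 0`) resp. of
`Ktz(n,|d|)` (for `d < 0`). -/
def fV (n : ℕ) (d : ℤ) (v : ℤ) : Rn n :=
  if 0 ≤ d then d • xp n ((v : ZMod n)) - xp n (((d * v : ℤ) : ZMod n)) * geomT n d
  else d • xp n ((v : ZMod n)) + xp n (((d * (v + 1) : ℤ) : ZMod n)) * geomT n d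

/-- `F_{n,d}`, the ℤ-span of the `f_v`, `1 ≤ v ≤ n-1`. -/
def FSpan (n : ℕ) (d : ℤ) : Submodule ℤ (Rn n) :=
  Submodule.span ℤ {a : Rn n | ∃ v : ℤ, 1 ≤ v ∧ v ≤ (n : ℤ) - 1 ∧ a = fV n d v}

/-- The sand dune group `Σ(n,d) = 𝒵_n / ℰ_{n,d}`. -/
abbrev SandDune (n : ℕ) (d : ℤ) :=
  ZSpan n ⧸ Submodule.comap (ZSpan n).subtype (ESpan n d)

/-- The sandpile (critical) group `S(n,d) = 𝒵_n / F_{n,d}`. -/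
abbrev Sandpile (n : ℕ) (d : ℤ) :=
  ZSpan n ⧸ Submodule.comap (ZSpan n).subtype (FSpan n d)

/-- The ℚ-algebra `ℚ[x]/(x^n - 1)`, realized as the group algebra `ℚ[ℤ/n]`. -/
abbrev Qn (n : ℕ) : Type := AddMonoidAlgebra ℚ (ZMod n)

/-- The class of `x^w` in `ℚ[x]/(x^n - 1)`. -/
def xq (n : ℕ) (w : ZMod n) : Qn n := AddMonoidAlgebra.single w 1

/-- `e_v = x^v - 1` in `ℚ[x]/(x^n - 1)`. -/
def eQ (n : ℕ) (w : ZMod n) : Qn n := xq n w - 1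

/-- `ε_v = d·e_v - e_{d·v}` in `ℚ[x]/(x^n - 1)`. -/
def epsQ (n : ℕ) (d : ℤ) (w : ZMod n) : Qn n := (d : ℚ) • eQ n w - eQ n ((d : ZMod n) * w)

/-- `g_v = d·x^v·(x − 1) − x^{d·v}·(x^d − 1)` in `ℚ[x]/(x^n - 1)`. -/
def gQ (n : ℕ) (d : ℤ) (w : ZMod n) : Qn n :=
  (d : ℚ) • (xq n w * (xq n 1 - 1)) - xq n ((d : ZMod n) * w) * (xq n (d : ZMod n) - 1)

/-- The Laplacian of `DB(n,d)` (for `d ≥ 0`) resp. of `Ktz(n,|d|)` (for `d < 0`):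
`Δ_{v,w} = |d|·[v = w] − #{0 ≤ i ≤ |d|−1 : w = (d·v resp. d·(v+1)) + i in ℤ/n}`. -/
def lap (n : ℕ) (d : ℤ) (v w : ZMod n) : ℤ :=
  (d.natAbs : ℤ) * (if v = w then 1 else 0) -
    (((Finset.range d.natAbs).filter
      (fun i : ℕ => w = (if 0 ≤ d then (d : ZMod n) * v else (d : ZMod n) * (v + 1)) + (i : ZMod n))).card : ℤ)

/-- The image of `f_v` in `ℚ[x]/(x^n - 1)`. -/
def fQ (n : ℕ) (d : ℤ) (v : ℤ) : Qn n :=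
  if 0 ≤ d then
    (d : ℚ) • xq n ((v : ZMod n)) -
      xq n (((d * v : ℤ) : ZMod n)) * ∑ i ∈ Finset.range d.natAbs, xq n (i : ZMod n)
  else
    (d : ℚ) • xq n ((v : ZMod n)) +
      xq n (((d * (v + 1) : ℤ) : ZMod n)) * ∑ i ∈ Finset.range d.natAbs, xq n (i : ZMod n)

/-- The first element `d·v` resp. `d·(v+1)` of the block of heads of the arcs leaving `v`. -/
def arcBase (n : ℕ) (d : ℤ) (v : ZMod n) : ZMod n :=
  if 0 ≤ d then (d : ZMod n) * v else (d : ZMod n) * (v + 1)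

lemma sum_range_mul_blocks {R : Type*} [AddCommMonoid R] (h : ℕ → R) (m n : ℕ) :
    ∑ v ∈ range n, ∑ i ∈ range m, h (m * v + i) = ∑ k ∈ range (m * n), h k := by
  induction n with
  | zero => simp
  | succ n ih => rw [sum_range_succ, ih, Nat.mul_succ, sum_range_add]

lemma sum_zmod_eq_sum_range {R : Type*} [AddCommMonoid R] (n : ℕ) [NeZero n] (g : ZMod n → R) :
    ∑ v, g v = ∑ k ∈ range n, g (k : ZMod n) := by
  refine sum_bij' (fun v _ => v.val) (fun k _ => (k : ZMod n)) ?_ ?_ ?_ ?_ ?_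
  · intro v _
    simpa using ZMod.val_lt v
  · simp
  · simp
  · intro k hk
    exact ZMod.val_cast_of_lt (by simpa using hk)
  · simp

lemma sum_range_mul_zmod {R : Type*} [AddCommMonoid R] (n : ℕ) [NeZero n] (g : ZMod n → R)
    (m : ℕ) : ∑ k ∈ range (m * n), g (k : ZMod n) = m • ∑ v, g v := by
  induction m with
  | zero => simp
  | succ m ih =>
    rw [Nat.succ_mul, sum_range_add, ih, succ_nsmul, sum_zmod_eq_sum_range]
    simp

lemma sum_heads_natCast {R : Type*} [AddCommMonoid R] (n : ℕ) [NeZero n] (g : ZMod n → R)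
    (m : ℕ) : ∑ v : ZMod n, ∑ i ∈ range m, g ((m : ZMod n) * v + (i : ZMod n)) = m • ∑ v, g v := by
  rw [sum_zmod_eq_sum_range, ← sum_range_mul_zmod,
    ← sum_range_mul_blocks (fun k => g (k : ZMod n)) m n]
  simp

/-- Every vertex has in-degree `|d|`. -/
lemma sum_heads {R : Type*} [AddCommMonoid R] (n : ℕ) [NeZero n] (d : ℤ) (g : ZMod n → R) :
    ∑ v, ∑ i ∈ range d.natAbs, g (arcBase n d v + (i : ZMod n)) = d.natAbs • ∑ v, g v := by
  rw [← sum_heads_natCast]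
  unfold arcBase
  split_ifs with hd
  · have : ((d.natAbs : ℕ) : ZMod n) = (d : ZMod n) := by
      conv_rhs => rw [← Int.natAbs_of_nonneg hd]
      simp
    rw [this]
  · have : ((d.natAbs : ℕ) : ZMod n) = -(d : ZMod n) := by
      have h : ((d.natAbs : ℕ) : ℤ) = -d := by omega
      have := congrArg (Int.cast : ℤ → ZMod n) h
      simpa using this
    rw [this, ← ((Equiv.addRight (1 : ZMod n)).trans (Equiv.neg (ZMod n))).sum_comp
      (fun v => ∑ i ∈ range d.natAbs, g (-(d : ZMod n) * v + (i : ZMod n)))]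
    refine sum_congr rfl fun v _ => sum_congr rfl fun i _ => ?_
    congr 1
    simp only [Equiv.trans_apply, Equiv.coe_addRight, Equiv.neg_apply]
    ring

lemma sum_lap_mul {R : Type*} [CommRing R] (n : ℕ) [NeZero n] (d : ℤ) (v : ZMod n)
    (g : ZMod n → R) :
    ∑ w, (lap n d v w : R) * g w =
      d.natAbs * g v - ∑ i ∈ range d.natAbs, g (arcBase n d v + (i : ZMod n)) := by
  have h (w : ZMod n) : (lap n d v w : R) * g w = (if v = w then d.natAbs * g w else 0) -
      ∑ i ∈ range d.natAbs, if w = arcBase n d v + (i : ZMod n) then g w else 0 := by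
    rw [← sum_filter, sum_const, nsmul_eq_mul, lap]
    simp only [arcBase]
    push_cast
    split_ifs <;> simp [sub_mul]
  simp_rw [h, sum_sub_distrib]
  rw [sum_comm (s := univ)]
  simp

lemma sum_lap_left (n : ℕ) [NeZero n] (d : ℤ) (w : ZMod n) : ∑ v, lap n d v w = 0 := by
  have h (v : ZMod n) := sum_lap_mul (R := ℤ) n d v (Pi.single w 1)
  simp only [Pi.single_apply, mul_ite, mul_one, mul_zero, sum_ite_eq', mem_univ, if_true,
    Int.cast_id] at h
  simp_rw [h, sum_sub_distrib]
  rw [sum_heads n d (fun u => if u = w then (1 : ℤ) else 0)]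
  simp

lemma sum_lap_right (n : ℕ) [NeZero n] (d : ℤ) (v : ZMod n) : ∑ w, lap n d v w = 0 := by
  simpa using sum_lap_mul (R := ℤ) n d v (fun _ => 1)

/-- A function constant along all arcs is constant. -/
lemma eq_of_const_on_arcs {R : Type*} (n : ℕ) [NeZero n] (d : ℤ) (hd : 2 ≤ |d|) (c : ZMod n → R)
    (hc : ∀ v, ∀ i ∈ range d.natAbs, c (arcBase n d v + (i : ZMod n)) = c v) (v : ZMod n) :
    c v = c 0 := by
  have hd0 : d ≠ 0 := by rintro rfl; simp at hd
  have key (u : ℤ) : c (u : ZMod n) =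
      c ((if 0 ≤ d then u / d else u / d - 1 : ℤ) : ZMod n) := by
    have hmod := Int.emod_nonneg u hd0
    have hlt := Int.emod_lt_abs u hd0
    rw [← hc ((if 0 ≤ d then u / d else u / d - 1 : ℤ) : ZMod n) (u % d).toNat (by rw [mem_range]; zify; omega)]
    congr 1
    have h1 : (((u % d).toNat : ℕ) : ZMod n) = ((u % d : ℤ) : ZMod n) := by
      rw [← Int.cast_natCast, Int.toNat_of_nonneg hmod]
    have h2 : (u : ZMod n) = d * ((u / d : ℤ) : ZMod n) + ((u % d : ℤ) : ZMod n) := by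
      rw [← Int.cast_mul, ← Int.cast_add, Int.mul_ediv_add_emod]
    rw [h1, h2]
    unfold arcBase
    split_ifs <;> push_cast <;> ring
  have main : ∀ k : ℕ, ∀ u : ℤ, (0 ≤ d → 0 ≤ u) →
      (if 0 ≤ u then 2 * u else -2 * u - 1).toNat = k → c (u : ZMod n) = c 0 := by
    intro k
    induction k using Nat.strong_induction_on with
    | _ k ih =>
      intro u hdu hu
      by_cases hu0 : u = 0
      · simp [hu0]
      · have h1 := Int.mul_ediv_add_emod u d
        have h2 := Int.emod_nonneg u hd0
        have h3 := Int.emod_lt_abs u hd0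
        rw [key u]
        refine ih _ ?_ _ (fun h => by rw [if_pos h]; exact Int.ediv_nonneg (hdu h) h) rfl
        subst hu
        generalize u / d = q at *
        generalize u % d = r at *
        rcases le_total 0 d with h0 | h0
        · rw [abs_of_nonneg h0] at hd h3
          have hu := hdu h0
          have hq0 : 0 ≤ q := by nlinarith
          have hq : q < u := by
            by_contra! h
            have : 1 ≤ q := by omega
            nlinarith
          simp only [h0, hu, hq0, if_true]
          omega
        · rw [abs_of_nonpos h0] at hd h3
          rw [if_neg (by omega : ¬ 0 ≤ d)]
          rcases lt_or_ge u 0 with hu | hu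
          · have hq1 : 1 ≤ q := by nlinarith
            have hq : q ≤ -u := by nlinarith
            rw [if_pos (by omega), if_neg (by omega)]
            omega
          · have hq1 : q ≤ 0 := by nlinarith
            have hq : -q + 1 ≤ u := by
              rcases eq_or_lt_of_le hq1 with h | h
              · omega
              · nlinarith
            rw [if_neg (by omega), if_pos hu]
            omega
  simpa using main _ (v.val : ℤ) (fun _ => Int.natCast_nonneg _) rfl

/-- Over an ordered ring the left kernel of the Laplacian consists of constants. -/
lemma eq_of_sum_mul_lap_eq_zero {R : Type*} [CommRing R] [LinearOrder R] [IsStrictOrderedRing R]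
    (n : ℕ) [NeZero n] (d : ℤ) (hd : 2 ≤ |d|) (c : ZMod n → R)
    (hc : ∀ w, ∑ v, c v * (lap n d v w : R) = 0) (v : ZMod n) : c v = c 0 := by
  have hz : ∑ v, c v * ∑ w, (lap n d v w : R) * c w = 0 := by
    simp_rw [mul_sum, ← mul_assoc]
    rw [sum_comm]
    simp_rw [← sum_mul, hc]
    simp
  have hE : ∑ v, ∑ i ∈ range d.natAbs, (c (arcBase n d v + (i : ZMod n)) - c v) ^ 2 = 0 := by
    have h1 : ∀ v, ∑ i ∈ range d.natAbs, (c (arcBase n d v + (i : ZMod n)) - c v) ^ 2 =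
        ∑ i ∈ range d.natAbs, c (arcBase n d v + (i : ZMod n)) ^ 2 - d.natAbs * c v ^ 2 +
          2 * (c v * ∑ w, (lap n d v w : R) * c w) := by
      intro v
      rw [sum_lap_mul]
      simp_rw [sub_sq, sum_add_distrib, sum_sub_distrib, mul_assoc, ← mul_sum, ← sum_mul]
      simp
      ring
    simp_rw [h1, sum_add_distrib, sum_sub_distrib, ← mul_sum]
    rw [hz, sum_heads n d (fun u => c u ^ 2)]
    simp
  refine eq_of_const_on_arcs n d hd c (fun v i hi => ?_) v
  rw [sum_eq_zero_iff_of_nonneg (fun v _ => sum_nonneg fun i _ => sq_nonneg _)] at hE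
  have h2 := hE v (mem_univ v)
  rw [sum_eq_zero_iff_of_nonneg (fun i _ => sq_nonneg _)] at h2
  exact sub_eq_zero.1 (pow_eq_zero_iff two_ne_zero |>.1 (h2 i hi))

lemma sign_mul_lap {R : Type*} [CommRing R] (n : ℕ) (d : ℤ) (v w : ZMod n) :
    (d.sign * lap n d v w : R) = d * (if v = w then 1 else 0) -
      d.sign * ∑ i ∈ range d.natAbs, if arcBase n d v + (i : ZMod n) = w then 1 else 0 := by
  have h : (d : R) = d.sign * d.natAbs := by
    conv_lhs => rw [← Int.sign_mul_natAbs d]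
    simp
  rw [h, sum_boole, lap, Int.cast_sub, Int.cast_mul, Int.cast_natCast, Int.cast_natCast]
  simp only [arcBase, eq_comm (b := w), Int.cast_ite, Int.cast_one, Int.cast_zero]
  ring

lemma coeff_fV (n : ℕ) (d : ℤ) (hd : d ≠ 0) (v : ℤ) (w : ZMod n) :
    (fV n d v).coeff w = d.sign * lap n d (v : ZMod n) w := by
  have h := sign_mul_lap (R := ℤ) n d v w
  simp only [Int.cast_id] at h
  rw [h, fV, geomT, arcBase]
  by_cases h0 : 0 ≤ d
  · rw [if_pos h0, if_pos h0, Int.sign_eq_one_of_pos (by omega)]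
    simp [xp, mul_sum, AddMonoidAlgebra.single_mul_single, Finsupp.single_apply]
  · rw [if_neg h0, if_neg h0, Int.sign_eq_neg_one_of_neg (by omega)]
    simp [xp, mul_sum, AddMonoidAlgebra.single_mul_single, Finsupp.single_apply]

lemma coeff_fQ (n : ℕ) (d : ℤ) (hd : d ≠ 0) (v : ℤ) (w : ZMod n) :
    (fQ n d v).coeff w = d.sign * lap n d (v : ZMod n) w := by
  rw [sign_mul_lap, fQ, arcBase]
  by_cases h0 : 0 ≤ d
  · rw [if_pos h0, if_pos h0, Int.sign_eq_one_of_pos (by omega)]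
    simp [xq, mul_sum, AddMonoidAlgebra.single_mul_single, Finsupp.single_apply]
  · rw [if_neg h0, if_neg h0, Int.sign_eq_neg_one_of_neg (by omega)]
    simp [xq, mul_sum, AddMonoidAlgebra.single_mul_single, Finsupp.single_apply]

lemma exists_intCast_eq (n : ℕ) [NeZero n] (w : ZMod n) (hw : w ≠ 0) :
    ∃ v : ℤ, 1 ≤ v ∧ v ≤ (n : ℤ) - 1 ∧ (v : ZMod n) = w := by
  have h1 := ZMod.val_lt w
  have h2 : w.val ≠ 0 := by simpa using hw
  exact ⟨w.val, by omega, by omega, by simp⟩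

/-- The coefficient vector, as a linear map. -/
def coeffVec (n : ℕ) : Rn n →ₗ[ℤ] (ZMod n → ℤ) where
  toFun x := x.coeff
  map_add' _ _ := rfl
  map_smul' _ _ := rfl

lemma coeffVec_injective (n : ℕ) : Function.Injective (coeffVec n) := fun _ _ h =>
  AddMonoidAlgebra.coeff_injective (DFunLike.coe_injective h)

lemma coeffVec_surjective (n : ℕ) [NeZero n] : Function.Surjective (coeffVec n) := fun g =>
  ⟨AddMonoidAlgebra.ofCoeff (Finsupp.equivFunOnFinite.symm g), rfl⟩

lemma coeffVec_xp (n : ℕ) (w : ZMod n) : coeffVec n (xp n w) = Pi.single w 1 := by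
  ext u
  change (AddMonoidAlgebra.single w (1 : ℤ)).coeff u = _
  simp [Finsupp.single_apply, Pi.single_apply, eq_comm]

/-- `ZSpan n` is the augmentation ideal. -/
lemma mem_ZSpan_iff (n : ℕ) [NeZero n] (x : Rn n) :
    x ∈ ZSpan n ↔ ∑ w, coeffVec n x w = 0 := by
  have hone : (1 : Rn n) = xp n 0 := rfl
  constructor
  · intro hx
    induction hx using Submodule.span_induction with
    | mem x hx =>
      obtain ⟨v, -, -, rfl⟩ := hx
      simp [eV, hone, coeffVec_xp]
    | zero => simp
    | add x y _ _ hx hy => simp [sum_add_distrib, hx, hy]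
    | smul a x _ hx => simp only [map_smul, Pi.smul_apply, smul_eq_mul, ← mul_sum, hx, mul_zero]
  · intro hx
    have h : x = ∑ w, coeffVec n x w • eV n w := by
      apply coeffVec_injective n
      simp only [eV, smul_sub, sum_sub_distrib, ← sum_smul, hx, zero_smul, sub_zero, map_sum,
        map_smul, coeffVec_xp]
      ext u
      simp [Pi.single_apply]
    rw [h]
    refine sum_mem fun w _ => Submodule.smul_mem _ _ ?_
    by_cases hw : w = 0
    · simp [hw, eV, hone]
    · obtain ⟨v, h1, h2, h3⟩ := exists_intCast_eq n w hw
      exact Submodule.subset_span ⟨v, h1, h2, by rw [h3]⟩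

lemma coeffVec_fV (n : ℕ) (d : ℤ) (hd : d ≠ 0) (v : ℤ) :
    coeffVec n (fV n d v) = d.sign • lap n d (v : ZMod n) :=
  funext fun w => coeff_fV n d hd v w

lemma map_FSpan (n : ℕ) [NeZero n] (d : ℤ) (hd : d ≠ 0) :
    (FSpan n d).map (coeffVec n) = Submodule.span ℤ (Set.range fun v : ZMod n => lap n d v) := by
  rw [FSpan, Submodule.map_span]
  refine le_antisymm (Submodule.span_le.2 ?_) (Submodule.span_le.2 ?_)
  · rintro _ ⟨_, ⟨v, -, -, rfl⟩, rfl⟩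
    rw [coeffVec_fV n d hd]
    exact Submodule.smul_mem _ _ (Submodule.subset_span ⟨_, rfl⟩)
  · have hne : ∀ w : ZMod n, w ≠ 0 → lap n d w ∈ Submodule.span ℤ
        (coeffVec n '' {a | ∃ v : ℤ, 1 ≤ v ∧ v ≤ (n : ℤ) - 1 ∧ a = fV n d v}) := by
      intro w hw
      obtain ⟨v, h1, h2, h3⟩ := exists_intCast_eq n w hw
      have h : lap n d w = d.sign • coeffVec n (fV n d v) := by
        rw [coeffVec_fV n d hd, smul_smul, ← Int.sign_mul, Int.sign_eq_one_of_pos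
          (mul_self_pos.2 hd), one_smul, h3]
      rw [h]
      exact Submodule.smul_mem _ _ (Submodule.subset_span ⟨_, ⟨v, h1, h2, rfl⟩, rfl⟩)
    rintro _ ⟨w, rfl⟩
    by_cases hw : w = 0
    · have h : lap n d 0 = -∑ v ∈ univ.erase (0 : ZMod n), lap n d v := by
        ext u
        rw [Pi.neg_apply, Finset.sum_apply, eq_neg_iff_add_eq_zero,
          add_sum_erase univ (fun v => lap n d v u) (mem_univ 0), sum_lap_left]
      simp only [hw, h]
      exact neg_mem (sum_mem fun v hv => hne v (ne_of_mem_erase hv))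
    · exact hne w hw

lemma sum_eq_zero_of_mem_span_lap (n : ℕ) [NeZero n] (d : ℤ) (g : ZMod n → ℤ)
    (hg : g ∈ Submodule.span ℤ (Set.range fun v : ZMod n => lap n d v)) : ∑ w, g w = 0 := by
  induction hg using Submodule.span_induction with
  | mem x hx =>
    obtain ⟨v, rfl⟩ := hx
    exact sum_lap_right n d v
  | zero => simp
  | add x y _ _ hx hy => simp [sum_add_distrib, hx, hy]
  | smul a x _ hx => simp [← mul_sum, hx]

lemma exists_smul_mem_span_lap (n : ℕ) [NeZero n] (d : ℤ) (hd : 2 ≤ |d|) :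
    ∃ k : ℤ, k ≠ 0 ∧ ∀ g : ZMod n → ℤ, ∑ w, g w = 0 →
      k • g ∈ Submodule.span ℤ (Set.range fun v : ZMod n => lap n d v) := by
  let M : Matrix (ZMod n) (ZMod n) ℤ :=
    Matrix.of fun v w => lap n d v w + (if v = 0 ∧ w = 0 then 1 else 0)
  have hM (c : ZMod n → ℤ) : Matrix.vecMul c M = ∑ v, c v • lap n d v + Pi.single 0 (c 0) := by
    ext w
    simp only [Matrix.vecMul, dotProduct, M, Matrix.of_apply, mul_add, sum_add_distrib,
      Pi.add_apply, Finset.sum_apply, Pi.smul_apply, smul_eq_mul, add_right_inj]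
    by_cases hw : w = 0 <;> simp [hw]
  have hmem (c : ZMod n → ℤ) : ∑ v, c v • lap n d v ∈
      Submodule.span ℤ (Set.range fun v : ZMod n => lap n d v) :=
    sum_mem fun v _ => Submodule.smul_mem _ _ (Submodule.subset_span ⟨v, rfl⟩)
  have hzero (c : ZMod n → ℤ) (h : ∑ w, Matrix.vecMul c M w = 0) : c 0 = 0 := by
    simp_rw [hM, Pi.add_apply] at h
    rw [sum_add_distrib, sum_eq_zero_of_mem_span_lap n d _ (hmem c)] at h
    simpa using h
  refine ⟨M.det, fun hdet => ?_, fun g hg => ?_⟩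
  · obtain ⟨c, hc, hcM⟩ := Matrix.exists_vecMul_eq_zero_iff.2 hdet
    have h0 := hzero c (by simp [hcM])
    rw [hM, h0, Pi.single_zero, add_zero] at hcM
    refine hc (funext fun v => ?_)
    rw [eq_of_sum_mul_lap_eq_zero n d hd c (fun w => by simpa using congrFun hcM w), h0]
    rfl
  · have h : Matrix.vecMul (Matrix.vecMul g M.adjugate) M = M.det • g := by
      rw [Matrix.vecMul_vecMul, Matrix.adjugate_mul, Matrix.vecMul_smul, Matrix.vecMul_one]
    have h0 := hzero (Matrix.vecMul g M.adjugate) (by simp [h, ← mul_sum, hg])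
    rw [← h, hM, h0, Pi.single_zero, add_zero]
    exact hmem _

lemma linearIndependent_fQ (n : ℕ) [NeZero n] (d : ℤ) (hd : 2 ≤ |d|) :
    LinearIndependent ℚ (fun v : Fin (n - 1) => fQ n d (v.1 + 1 : ℤ)) := by
  have hd0 : d ≠ 0 := by rintro rfl; simp at hd
  have hval (j : Fin (n - 1)) : ((j.1 + 1 : ℕ) : ZMod n).val = j.1 + 1 :=
    ZMod.val_cast_of_lt (by omega)
  rw [Fintype.linearIndependent_iff]
  intro g hg j
  let c : ZMod n → ℚ := fun v => ∑ i, g i * if ((i.1 + 1 : ℕ) : ZMod n) = v then 1 else 0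
  have hcj : c ((j.1 + 1 : ℕ) : ZMod n) = g j := by
    have h (i : Fin (n - 1)) : ((i.1 + 1 : ℕ) : ZMod n) = ((j.1 + 1 : ℕ) : ZMod n) ↔ i = j := by
      refine ⟨fun h => ?_, fun h => by rw [h]⟩
      have := congrArg ZMod.val h
      rw [hval, hval] at this
      exact Fin.ext (by omega)
    simp only [c, h]
    simp
  have hc0 : c 0 = 0 := by
    refine sum_eq_zero fun i _ => ?_
    rw [if_neg, mul_zero]
    intro h
    have := congrArg ZMod.val h
    rw [hval, ZMod.val_zero] at this
    omega
  rw [← hcj, eq_of_sum_mul_lap_eq_zero n d hd c (fun w => ?_), hc0]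
  have hw := congrArg (fun x : Qn n => x.coeff w) hg
  simp only [AddMonoidAlgebra.coeff_sum, Finsupp.finsetSum_apply, AddMonoidAlgebra.coeff_smul,
    Finsupp.smul_apply, coeff_fQ n d hd0, smul_eq_mul, AddMonoidAlgebra.coeff_zero,
    Finsupp.zero_apply] at hw
  have hs : (d.sign : ℚ) ≠ 0 := by exact_mod_cast mt Int.sign_eq_zero_iff_zero.1 hd0
  refine (mul_eq_zero.1 (?_ : (d.sign : ℚ) * _ = 0)).resolve_left hs
  rw [← hw]
  simp only [c, sum_mul]
  rw [sum_comm, mul_sum]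
  refine sum_congr rfl fun i _ => ?_
  simp
  ring

/-- The natural map from `𝒵_n` to the cokernel of the Laplacian. -/
def toCoker (n : ℕ) (d : ℤ) : ZSpan n →ₗ[ℤ]
    (ZMod n → ℤ) ⧸ Submodule.span ℤ (Set.range fun v : ZMod n => lap n d v) :=
  (Submodule.mkQ _ ∘ₗ coeffVec n) ∘ₗ (ZSpan n).subtype

lemma ker_toCoker (n : ℕ) [NeZero n] (d : ℤ) (hd : d ≠ 0) :
    LinearMap.ker (toCoker n d) = Submodule.comap (ZSpan n).subtype (FSpan n d) := by
  rw [toCoker, LinearMap.ker_comp, LinearMap.ker_comp, Submodule.ker_mkQ, ← map_FSpan n d hd,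
    Submodule.comap_map_eq_of_injective (coeffVec_injective n)]

lemma range_toCoker (n : ℕ) [NeZero n] (d : ℤ) (hd : 2 ≤ |d|) :
    (LinearMap.range (toCoker n d)).toAddSubgroup = AddCommGroup.torsion _ := by
  obtain ⟨k, hk, hkg⟩ := exists_smul_mem_span_lap n d hd
  ext y
  rw [Submodule.mem_toAddSubgroup, AddCommGroup.mem_torsion, isOfFinAddOrder_iff_zsmul_eq_zero]
  constructor
  · rintro ⟨x, rfl⟩
    exact ⟨k, hk, (Submodule.Quotient.mk_eq_zero _).2 (hkg _ ((mem_ZSpan_iff n x).1 x.2))⟩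
  · rintro ⟨m, hm, hmy⟩
    obtain ⟨g, rfl⟩ := Submodule.mkQ_surjective _ y
    obtain ⟨x, rfl⟩ := coeffVec_surjective n g
    have h := sum_eq_zero_of_mem_span_lap n d _ ((Submodule.Quotient.mk_eq_zero _).1 hmy)
    simp only [Pi.smul_apply, smul_eq_mul, ← mul_sum] at h
    exact ⟨⟨x, (mem_ZSpan_iff n x).2 ((mul_eq_zero.1 h).resolve_left hm)⟩, rfl⟩

/-- the images of the `f_v` (`1 ≤ v ≤ n−1`) in `ℚ[x]/(x^n−1)` are
ℚ-linearly independent, `S(n,d)` is finite, and `S(n,d)` is isomorphic to the torsion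
subgroup of the quotient of `ℤ^n` by the row space of the Laplacian of `DB(n,d)`
(if `d ≥ 2`) or `Ktz(n,|d|)` (if `d ≤ −2`), i.e. to the critical group. -/
theorem stmt2 (n : ℕ) (d : ℤ) (hn : 1 ≤ n) (hd : 2 ≤ |d|) :
    LinearIndependent ℚ (fun v : Fin (n - 1) => fQ n d (v.1 + 1 : ℤ)) ∧
    Finite (Sandpile n d) ∧
    Nonempty (Sandpile n d ≃+
      AddCommGroup.torsion
        ((ZMod n → ℤ) ⧸ Submodule.span ℤ (Set.range fun v : ZMod n => lap n d v))) := by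
  have : NeZero n := ⟨by omega⟩
  have hd0 : d ≠ 0 := by rintro rfl; simp at hd
  have e : Sandpile n d ≃+ AddCommGroup.torsion
      ((ZMod n → ℤ) ⧸ Submodule.span ℤ (Set.range fun v : ZMod n => lap n d v)) :=
    ((Submodule.quotEquivOfEq _ _ (ker_toCoker n d hd0).symm).trans
      (toCoker n d).quotKerEquivRange).toAddEquiv.trans
      (AddEquiv.addSubgroupCongr (range_toCoker n d hd))
  have hfin : Module.Finite ℤ (Sandpile n d) :=
    Module.Finite.equiv (M := LinearMap.range (toCoker n d))
      ((Submodule.quotEquivOfEq _ _ (ker_toCoker n d hd0).symm).trans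
        (toCoker n d).quotKerEquivRange).symm
  refine ⟨linearIndependent_fQ n d hd, ?_, ⟨e⟩⟩
  have : AddGroup.FG (Sandpile n d) := Module.Finite.iff_addGroup_fg.1 hfin
  exact AddCommGroup.finite_of_fg_isAddTorsion _ fun x =>
    (e.injective.isOfFinAddOrder_iff (f := e.toAddMonoidHom)).1
      (AddSubmonoid.isOfFinAddOrder_coe.1 (e x).2)
end
end

section
/- Let n ≥ 1 and d be integers with |d| ≥ 2. Then: (i) the sand dune group Σ(n,d) is finite; (ii) multiplication by x − 1 maps 𝒵_n into 𝒵_n and maps F_{n,d} into ℰ_{n,d}, and the induced group homomorphism φ : S(n,d) → Σ(n,d) is injective; (iii) for integers a_1, …, a_{n−1}, the class of Σ_{v=1}^{n−1} a_v·e_v in Σ(n,d) lies in the image of φ if and only if Σ_{v=1}^{n−1} v·a_v ≡ 0 (mod n). -/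
open Finset

noncomputable section

lemma xp_zero (n : ℕ) : xp n 0 = 1 := rfl

lemma xp_mul_xp (n : ℕ) (v w : ZMod n) : xp n v * xp n w = xp n (v + w) := by
  simp [xp]

lemma eV_zero (n : ℕ) : eV n 0 = 0 := by
  simp [eV, xp_zero]

lemma epsV_zero (n : ℕ) (d : ℤ) : epsV n d 0 = 0 := by
  simp [epsV, eV_zero]

lemma single_eq_smul_xp (n : ℕ) (w : ZMod n) (r : ℤ) :
    (AddMonoidAlgebra.single w r : Rn n) = r • xp n w := by
  simp [xp]

/-- The linear map on `ℤ[x]/(x^n - 1)` sending `x^w` to `g w`. -/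
def weightMap (n : ℕ) {A : Type*} [AddCommGroup A] (g : ZMod n → A) : Rn n →ₗ[ℤ] A :=
  Finsupp.linearCombination ℤ g ∘ₗ (AddMonoidAlgebra.coeffLinearEquiv ℤ).toLinearMap

lemma weightMap_xp (n : ℕ) {A : Type*} [AddCommGroup A] (g : ZMod n → A) (w : ZMod n) :
    weightMap n g (xp n w) = g w := by
  simp [weightMap, xp]

/-- A nonzero residue is the class of an integer between `1` and `n - 1`. -/
lemma exists_int_rep (n : ℕ) (hn : 1 ≤ n) (w : ZMod n) (hw : w ≠ 0) :
    ∃ v : ℤ, 1 ≤ v ∧ v ≤ (n : ℤ) - 1 ∧ (v : ZMod n) = w := by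
  have : NeZero n := ⟨by omega⟩
  have h1 := ZMod.val_lt w
  have h2 : w.val ≠ 0 := fun h => hw ((ZMod.val_eq_zero w).1 h)
  exact ⟨w.val, by omega, by omega, by simp⟩

lemma eV_mem_ZSpan (n : ℕ) (hn : 1 ≤ n) (w : ZMod n) : eV n w ∈ ZSpan n := by
  by_cases hw : w = 0
  · simp [hw, eV_zero]
  · obtain ⟨v, h1, h2, rfl⟩ := exists_int_rep n hn w hw
    exact Submodule.subset_span ⟨v, h1, h2, rfl⟩

lemma epsV_mem_ESpan (n : ℕ) (d : ℤ) (hn : 1 ≤ n) (w : ZMod n) : epsV n d w ∈ ESpan n d := by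
  by_cases hw : w = 0
  · simp [hw, epsV_zero]
  · obtain ⟨v, h1, h2, rfl⟩ := exists_int_rep n hn w hw
    exact Submodule.subset_span ⟨v, h1, h2, rfl⟩

lemma weightMap_one_of_mem_ZSpan (n : ℕ) {a : Rn n} (ha : a ∈ ZSpan n) :
    weightMap n (fun _ => (1 : ℤ)) a = 0 := by
  have h : ZSpan n ≤ LinearMap.ker (weightMap n (fun _ => (1 : ℤ))) := by
    refine Submodule.span_le.2 ?_
    rintro _ ⟨v, -, -, rfl⟩
    simp [eV, ← xp_zero, weightMap_xp]
  exact h ha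

/-- `x - 1` times the whole ring lies in the augmentation ideal. -/
lemma sub_one_mul_mem_ZSpan (n : ℕ) (hn : 1 ≤ n) (a : Rn n) : (xp n 1 - 1) * a ∈ ZSpan n := by
  induction a using AddMonoidAlgebra.induction_linear with
  | zero => simp
  | add x y hx hy => rw [mul_add]; exact add_mem hx hy
  | single w r =>
    rw [single_eq_smul_xp, mul_smul_comm]
    refine Submodule.smul_mem _ _ ?_
    have : (xp n 1 - 1) * xp n w = eV n (1 + w) - eV n w := by
      rw [sub_mul, xp_mul_xp]; simp [eV]
    rw [this]
    exact sub_mem (eV_mem_ZSpan n hn _) (eV_mem_ZSpan n hn _)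

/-- Multiplication by `x - 1` is injective on the augmentation ideal. -/
lemma eq_zero_of_sub_one_mul_eq_zero (n : ℕ) (hn : 1 ≤ n) {a : Rn n} (ha : a ∈ ZSpan n)
    (h : (xp n 1 - 1) * a = 0) : a = 0 := by
  have : NeZero n := ⟨by omega⟩
  have h1 : xp n 1 * a = a := by rwa [sub_mul, one_mul, sub_eq_zero] at h
  have h2 : ∀ k : ℕ, xp n (k : ZMod n) * a = a := by
    intro k
    induction k with
    | zero => simp [xp_zero]
    | succ k ih => rw [Nat.cast_succ, ← xp_mul_xp, mul_assoc, h1, ih]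
  have h3 : ∀ w : ZMod n, a.coeff w = a.coeff 0 := by
    intro w
    have h4 := congrArg (fun b : Rn n => b.coeff w) (h2 w.val)
    simp only [ZMod.natCast_val, ZMod.cast_id', id_eq, xp,
      AddMonoidAlgebra.coeff_single_mul_apply] at h4
    simpa using h4.symm
  have h5 := weightMap_one_of_mem_ZSpan n ha
  have h6 : weightMap n (fun _ => (1 : ℤ)) a = n * a.coeff 0 := by
    simp [weightMap, Finsupp.linearCombination_apply, Finsupp.sum_fintype, h3, ZMod.card]
  have h7 : a.coeff 0 = 0 := by
    rw [h6] at h5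
    simpa [NeZero.ne n] using h5
  ext w
  simp [h3 w, h7]

lemma sub_one_mul_geomT (n : ℕ) (d : ℤ) :
    (xp n 1 - 1) * geomT n d = xp n (d.natAbs : ZMod n) - 1 := by
  unfold geomT
  induction d.natAbs with
  | zero => simp [xp_zero]
  | succ k ih =>
    rw [Finset.sum_range_succ, mul_add, ih, sub_mul, xp_mul_xp, Nat.cast_succ, add_comm 1]
    ring

lemma sub_one_mul_fV (n : ℕ) (d v : ℤ) :
    (xp n 1 - 1) * fV n d v = epsV n d ((v + 1 : ℤ) : ZMod n) - epsV n d (v : ZMod n) := by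
  have key : ∀ u : ZMod n, (xp n 1 - 1) * (xp n u * geomT n d)
      = xp n (u + (d.natAbs : ZMod n)) - xp n u := by
    intro u
    rw [mul_left_comm, sub_one_mul_geomT, mul_sub, xp_mul_xp, mul_one]
  have hx : (xp n 1 - 1) * xp n (v : ZMod n) = xp n ((v + 1 : ℤ) : ZMod n) - xp n (v : ZMod n) := by
    rw [sub_mul, xp_mul_xp, one_mul]; push_cast; rw [add_comm]
  unfold fV
  split_ifs with hd
  · have h : ((d * v : ℤ) : ZMod n) + (d.natAbs : ZMod n) = (d : ZMod n) * ((v + 1 : ℤ) : ZMod n) := by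
      have : ((d.natAbs : ℤ) : ZMod n) = (d : ZMod n) := by rw [Int.natAbs_of_nonneg hd]
      rw [Int.cast_natCast] at this
      rw [this]; push_cast; ring
    rw [mul_sub, mul_smul_comm, key, hx, h, epsV, epsV]
    simp only [eV, smul_sub]
    push_cast
    abel
  · have h : ((d * (v + 1) : ℤ) : ZMod n) + (d.natAbs : ZMod n) = (d : ZMod n) * (v : ZMod n) := by
      have : ((d.natAbs : ℤ) : ZMod n) = ((-d : ℤ) : ZMod n) := by
        rw [Int.ofNat_natAbs_of_nonpos (by omega)]
      rw [Int.cast_natCast] at this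
      rw [this]; push_cast; ring
    rw [mul_add, mul_smul_comm, key, hx, h, epsV, epsV]
    simp only [eV, smul_sub]
    push_cast
    abel

/-- An element whose coefficients sum to zero lies in the augmentation ideal. -/
lemma mem_ZSpan_of_weightMap_eq_zero (n : ℕ) (hn : 1 ≤ n) {a : Rn n}
    (ha : weightMap n (fun _ => (1 : ℤ)) a = 0) : a ∈ ZSpan n := by
  have h : ∀ b : Rn n, b - weightMap n (fun _ => (1 : ℤ)) b • 1 ∈ ZSpan n := by
    intro b
    induction b using AddMonoidAlgebra.induction_linear with
    | zero => simp
    | add x y hx hy =>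
      have := add_mem hx hy
      rw [map_add, add_smul]
      convert this using 1
      abel
    | single w r =>
      rw [single_eq_smul_xp, map_smul, weightMap_xp, smul_eq_mul, mul_one, ← smul_sub]
      exact Submodule.smul_mem _ _ (eV_mem_ZSpan n hn w)
  simpa [ha] using h a

lemma fV_mem_ZSpan (n : ℕ) (d v : ℤ) (hn : 1 ≤ n) : fV n d v ∈ ZSpan n := by
  apply mem_ZSpan_of_weightMap_eq_zero n hn
  unfold fV geomT
  split_ifs with hd
  · simp only [Finset.mul_sum, xp_mul_xp, map_sub, map_smul, map_sum, weightMap_xp]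
    simp [abs_of_nonneg hd]
  · simp only [Finset.mul_sum, xp_mul_xp, map_add, map_smul, map_sum, weightMap_xp]
    simp [abs_of_neg (not_le.1 hd)]

lemma FSpan_le_ZSpan (n : ℕ) (d : ℤ) (hn : 1 ≤ n) : FSpan n d ≤ ZSpan n := by
  refine Submodule.span_le.2 ?_
  rintro _ ⟨v, -, -, rfl⟩
  exact fV_mem_ZSpan n d v hn

lemma sub_one_mul_sum_fV (n : ℕ) (d : ℤ) (k : ℕ) :
    (xp n 1 - 1) * ∑ v ∈ Finset.range k, fV n d (v : ℤ) = epsV n d (k : ZMod n) := by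
  induction k with
  | zero => simp [epsV_zero]
  | succ k ih =>
    rw [Finset.sum_range_succ, mul_add, ih, sub_one_mul_fV]
    push_cast
    abel

/-- The rows `f_0, …, f_{n-1}` sum to zero, so `f_0` lies in the span of the others. -/
lemma fV_mem_FSpan (n : ℕ) (d : ℤ) (hn : 1 ≤ n) (k : ℕ) (hk : k < n) :
    fV n d (k : ℤ) ∈ FSpan n d := by
  have hpos : ∀ k : ℕ, 1 ≤ k → k < n → fV n d (k : ℤ) ∈ FSpan n d := fun k h1 h2 =>
    Submodule.subset_span ⟨k, by omega, by omega, rfl⟩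
  rcases Nat.eq_zero_or_pos k with rfl | h1
  · have hsum : ∑ v ∈ Finset.range n, fV n d (v : ℤ) = 0 := by
      refine eq_zero_of_sub_one_mul_eq_zero n hn
        (sum_mem fun v _ => fV_mem_ZSpan n d v hn) ?_
      rw [sub_one_mul_sum_fV]
      simp [epsV_zero]
    obtain ⟨m, rfl⟩ : ∃ m, n = m + 1 := ⟨n - 1, by omega⟩
    rw [Finset.sum_range_succ'] at hsum
    rw [eq_neg_of_add_eq_zero_right hsum]
    refine neg_mem (sum_mem fun v hv => hpos _ (by omega) ?_)
    have := Finset.mem_range.1 hv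
    omega
  · exact hpos k h1 hk

lemma sub_one_mul_mem_ESpan (n : ℕ) (d : ℤ) (hn : 1 ≤ n) {a : Rn n} (ha : a ∈ FSpan n d) :
    (xp n 1 - 1) * a ∈ ESpan n d := by
  have h : FSpan n d ≤ (ESpan n d).comap (LinearMap.mulLeft ℤ (xp n 1 - 1)) := by
    refine Submodule.span_le.2 ?_
    rintro _ ⟨v, -, -, rfl⟩
    simp only [Submodule.comap_coe, Set.mem_preimage, LinearMap.mulLeft_apply, SetLike.mem_coe]
    rw [sub_one_mul_fV]
    exact sub_mem (epsV_mem_ESpan n d hn _) (epsV_mem_ESpan n d hn _)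
  exact h ha

/-- `ℰ_{n,d}` is contained in `(x - 1) F_{n,d}`. -/
lemma exists_sub_one_mul_of_mem_ESpan (n : ℕ) (d : ℤ) (hn : 1 ≤ n) {b : Rn n}
    (hb : b ∈ ESpan n d) : ∃ a ∈ FSpan n d, (xp n 1 - 1) * a = b := by
  have h : ESpan n d ≤ (FSpan n d).map (LinearMap.mulLeft ℤ (xp n 1 - 1)) := by
    refine Submodule.span_le.2 ?_
    rintro _ ⟨v, h1, h2, rfl⟩
    refine ⟨∑ k ∈ Finset.range v.toNat, fV n d (k : ℤ), sum_mem fun k hk => ?_, ?_⟩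
    · refine fV_mem_FSpan n d hn k ?_
      have := Finset.mem_range.1 hk
      omega
    · rw [LinearMap.mulLeft_apply, sub_one_mul_sum_fV, ← Int.cast_natCast,
        Int.toNat_of_nonneg (by omega)]
  exact h hb

lemma eV_natCast_sub_mem (n : ℕ) (hn : 1 ≤ n) (k : ℕ) :
    eV n (k : ZMod n) - (k : ℤ) • (xp n 1 - 1) ∈
      (ZSpan n).map (LinearMap.mulLeft ℤ (xp n 1 - 1)) := by
  induction k with
  | zero => simp [eV_zero]
  | succ k ih =>
    have h : (xp n 1 - 1) * eV n (k : ZMod n) ∈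
        (ZSpan n).map (LinearMap.mulLeft ℤ (xp n 1 - 1)) :=
      ⟨_, eV_mem_ZSpan n hn _, rfl⟩
    convert add_mem ih h using 1
    rw [eV, Nat.cast_succ, ← xp_mul_xp]
    simp only [eV, zsmul_eq_mul]
    push_cast
    ring

lemma weightMap_id_sub_one_mul (n : ℕ) (a : Rn n) :
    weightMap n (fun w => w) ((xp n 1 - 1) * a) =
      ((weightMap n (fun _ => (1 : ℤ)) a : ℤ) : ZMod n) := by
  induction a using AddMonoidAlgebra.induction_linear with
  | zero => simp
  | add x y hx hy => rw [mul_add, map_add, hx, hy, map_add, Int.cast_add]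
  | single w r =>
    rw [single_eq_smul_xp, mul_smul_comm, sub_mul, xp_mul_xp, one_mul, map_smul, map_smul, map_sub,
      weightMap_xp, weightMap_xp, weightMap_xp]
    simp

/-- The square of the augmentation ideal is cut out by the weight `x^w ↦ w`. -/
lemma exists_sub_one_mul_iff (n : ℕ) (hn : 1 ≤ n) {b : Rn n} (hb : b ∈ ZSpan n) :
    (∃ a ∈ ZSpan n, (xp n 1 - 1) * a = b) ↔ weightMap n (fun w => w) b = 0 := by
  constructor
  · rintro ⟨a, ha, rfl⟩
    rw [weightMap_id_sub_one_mul, weightMap_one_of_mem_ZSpan n ha, Int.cast_zero]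
  · intro h
    set J := (ZSpan n).map (LinearMap.mulLeft ℤ (xp n 1 - 1)) with hJ
    have hn1 : (n : ℤ) • (xp n 1 - 1) ∈ J := by
      have := eV_natCast_sub_mem n hn n
      rw [ZMod.natCast_self, eV_zero, zero_sub, neg_mem_iff] at this
      exact this
    have hrep : ∃ m : ℤ, b - m • (xp n 1 - 1) ∈ J := by
      have hle : ZSpan n ≤ J ⊔ Submodule.span ℤ {xp n 1 - 1} := by
        refine Submodule.span_le.2 ?_
        rintro _ ⟨v, h1, -, rfl⟩
        refine Submodule.mem_sup.2 ⟨_, eV_natCast_sub_mem n hn v.toNat, v • (xp n 1 - 1),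
          Submodule.smul_mem _ _ (Submodule.mem_span_singleton_self _), ?_⟩
        rw [← Int.cast_natCast, Int.toNat_of_nonneg (by omega)]
        abel
      obtain ⟨y, hy, z, hz, rfl⟩ := Submodule.mem_sup.1 (hle hb)
      obtain ⟨m, rfl⟩ := Submodule.mem_span_singleton.1 hz
      exact ⟨m, by simpa using hy⟩
    obtain ⟨m, a, ha, hm⟩ := hrep
    rw [LinearMap.mulLeft_apply] at hm
    have hw := weightMap_id_sub_one_mul n a
    rw [weightMap_one_of_mem_ZSpan n ha, hm, map_sub, h, map_smul, map_sub, ← xp_zero,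
      weightMap_xp, weightMap_xp] at hw
    have hm0 : (m : ZMod n) = 0 := by simpa using hw
    obtain ⟨q, rfl⟩ := (ZMod.intCast_zmod_eq_zero_iff_dvd m n).1 hm0
    have hbJ : b ∈ J := by
      have h1 : b - ((n : ℤ) * q) • (xp n 1 - 1) ∈ J := ⟨a, ha, hm⟩
      have h2 := Submodule.smul_mem J q hn1
      rw [smul_smul, mul_comm] at h2
      simpa using add_mem h1 h2
    exact hbJ

lemma pow_smul_eV_sub_mem (n : ℕ) (d : ℤ) (hn : 1 ≤ n) (k : ℕ) (w : ZMod n) :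
    d ^ k • eV n w - eV n ((d : ZMod n) ^ k * w) ∈ ESpan n d := by
  induction k with
  | zero => simp
  | succ k ih =>
    convert add_mem (Submodule.smul_mem _ d ih)
      (epsV_mem_ESpan n d hn ((d : ZMod n) ^ k * w)) using 1
    rw [epsV, smul_sub, smul_smul, pow_succ', pow_succ', mul_assoc]
    abel

/-- Some nonzero integer annihilates the sand dune group. -/
lemma exists_ne_zero_smul_mem_ESpan (n : ℕ) (d : ℤ) (hn : 1 ≤ n) (hd : 2 ≤ |d|) :
    ∃ m : ℤ, m ≠ 0 ∧ ∀ a ∈ ZSpan n, m • a ∈ ESpan n d := by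
  have : NeZero n := ⟨by omega⟩
  obtain ⟨i, j, hij, h⟩ :
      ∃ i j : ℕ, i ≠ j ∧ (d : ZMod n) ^ i = (d : ZMod n) ^ j :=
    Finite.exists_ne_map_eq_of_infinite (fun k : ℕ => (d : ZMod n) ^ k)
  refine ⟨d ^ i - d ^ j, fun h0 => hij ?_, fun a ha => ?_⟩
  · exact Int.pow_right_injective (by rw [Int.abs_eq_natAbs] at hd; omega) (sub_eq_zero.1 h0)
  · have hle : ZSpan n ≤ (ESpan n d).comap (LinearMap.lsmul ℤ (Rn n) (d ^ i - d ^ j)) := by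
      refine Submodule.span_le.2 ?_
      rintro _ ⟨v, -, -, rfl⟩
      have := sub_mem (pow_smul_eV_sub_mem n d hn i v) (pow_smul_eV_sub_mem n d hn j v)
      rw [h, sub_sub_sub_cancel_right, ← sub_smul] at this
      exact this
    exact hle ha

lemma finite_sandDune (n : ℕ) (d : ℤ) (hn : 1 ≤ n) (hd : 2 ≤ |d|) : Finite (SandDune n d) := by
  have : NeZero n := ⟨by omega⟩
  have : Module.Finite ℤ (Rn n) :=
    Module.Finite.equiv (AddMonoidAlgebra.coeffLinearEquiv (S := ℤ) (M := ZMod n) ℤ).symm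
  obtain ⟨m, hm0, hm⟩ := exists_ne_zero_smul_mem_ESpan n d hn hd
  refine Module.finite_of_fg_torsion _ ?_
  intro x
  refine ⟨⟨m, mem_nonZeroDivisors_of_ne_zero hm0⟩, ?_⟩
  obtain ⟨⟨a, ha⟩, rfl⟩ := Submodule.Quotient.mk_surjective _ x
  exact (Submodule.Quotient.mk_eq_zero _).2 (hm a ha)

/-- (i) `Σ(n,d)` is finite; (ii) multiplication by `x − 1` maps `𝒵_n`
into `𝒵_n` and `F_{n,d}` into `ℰ_{n,d}`, and the induced homomorphism
`φ : S(n,d) → Σ(n,d)` is injective; (iii) the class of `Σ_{v=1}^{n−1} a_v·e_v` in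
`Σ(n,d)` lies in the image of `φ` iff `Σ_{v=1}^{n−1} v·a_v ≡ 0 (mod n)`. -/
theorem stmt3 (n : ℕ) (d : ℤ) (hn : 1 ≤ n) (hd : 2 ≤ |d|) :
    Finite (SandDune n d) ∧
    (∀ a ∈ ZSpan n, (xp n 1 - 1) * a ∈ ZSpan n) ∧
    (∀ a ∈ FSpan n d, (xp n 1 - 1) * a ∈ ESpan n d) ∧
    ∃ φ : Sandpile n d →+ SandDune n d,
      Function.Injective φ ∧
      (∀ (a : Rn n) (ha : a ∈ ZSpan n) (hb : (xp n 1 - 1) * a ∈ ZSpan n),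
        φ ((Submodule.Quotient.mk ⟨a, ha⟩ : Sandpile n d)) =
          (Submodule.Quotient.mk ⟨(xp n 1 - 1) * a, hb⟩ : SandDune n d)) ∧
      (∀ (c : ℕ → ℤ)
        (hmem : (∑ v ∈ Finset.Icc 1 (n - 1), c v • eV n ((v : ℕ) : ZMod n)) ∈ ZSpan n),
        ((Submodule.Quotient.mk
            ⟨∑ v ∈ Finset.Icc 1 (n - 1), c v • eV n ((v : ℕ) : ZMod n), hmem⟩ :
          SandDune n d) ∈ Set.range φ ↔
          (n : ℤ) ∣ ∑ v ∈ Finset.Icc 1 (n - 1), (v : ℤ) * c v)) := by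
  have hF : ∀ a ∈ FSpan n d, (xp n 1 - 1) * a ∈ ESpan n d :=
    fun a ha => sub_one_mul_mem_ESpan n d hn ha
  have hZ : ∀ a ∈ ZSpan n, (xp n 1 - 1) * a ∈ ZSpan n := fun a _ => sub_one_mul_mem_ZSpan n hn a
  refine ⟨finite_sandDune n d hn hd, hZ, hF, ?_⟩
  let f : ZSpan n →ₗ[ℤ] ZSpan n := (LinearMap.mulLeft ℤ (xp n 1 - 1)).restrict hZ
  let φ : Sandpile n d →ₗ[ℤ] SandDune n d := Submodule.mapQ _ _ f fun a ha => hF a ha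
  refine ⟨φ.toAddMonoidHom, ?_, fun a ha hb => rfl, fun c hmem => ?_⟩
  · rw [injective_iff_map_eq_zero]
    intro y hy
    obtain ⟨⟨a, ha⟩, rfl⟩ := Submodule.Quotient.mk_surjective _ y
    have hE : (xp n 1 - 1) * a ∈ ESpan n d :=
      (Submodule.Quotient.mk_eq_zero (Submodule.comap (ZSpan n).subtype (ESpan n d))).1 hy
    obtain ⟨b, hb, hab⟩ := exists_sub_one_mul_of_mem_ESpan n d hn hE
    have h0 : a - b = 0 := eq_zero_of_sub_one_mul_eq_zero n hn
      (sub_mem ha (FSpan_le_ZSpan n d hn hb)) (by rw [mul_sub, hab, sub_self])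
    refine (Submodule.Quotient.mk_eq_zero _).2 ?_
    rwa [← sub_eq_zero.1 h0] at hb
  · have hw : weightMap n (fun w => w)
        (∑ v ∈ Finset.Icc 1 (n - 1), c v • eV n ((v : ℕ) : ZMod n)) =
        ((∑ v ∈ Finset.Icc 1 (n - 1), (v : ℤ) * c v : ℤ) : ZMod n) := by
      rw [map_sum, Int.cast_sum]
      refine Finset.sum_congr rfl fun v _ => ?_
      rw [map_smul, eV, map_sub, ← xp_zero, weightMap_xp, weightMap_xp]
      simp [mul_comm]
    rw [← ZMod.intCast_zmod_eq_zero_iff_dvd, ← hw, ← exists_sub_one_mul_iff n hn hmem]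
    constructor
    · rintro ⟨y, hy⟩
      obtain ⟨⟨a, ha⟩, rfl⟩ := Submodule.Quotient.mk_surjective _ y
      have hE : (xp n 1 - 1) * a -
          ∑ v ∈ Finset.Icc 1 (n - 1), c v • eV n ((v : ℕ) : ZMod n) ∈ ESpan n d :=
        (Submodule.Quotient.eq (Submodule.comap (ZSpan n).subtype (ESpan n d))).1 hy
      obtain ⟨b, hb, hab⟩ := exists_sub_one_mul_of_mem_ESpan n d hn hE
      exact ⟨a - b, sub_mem ha (FSpan_le_ZSpan n d hn hb), by rw [mul_sub, hab, sub_sub_cancel]⟩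
    · rintro ⟨a, ha, hab⟩
      exact ⟨Submodule.Quotient.mk ⟨a, ha⟩,
        congrArg Submodule.Quotient.mk (Subtype.ext hab)⟩
end
end
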